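/- arXiv:1901.10076 — 2 statements merged into one kernel-verified Lean document; each statement's English description precedes it below -/
import Mathlib

section
/- Let H_x, H_y be complex Hilbert spaces, 1 ≤ p < ∞, B > 0, and T_p = { T ∈ S_p(H_x, H_y) : ‖T‖_{S_p} ≤ B }. Let (x_1,y_1),…,(x_N,y_N) be i.i.d. samples from a probability measure P on Z = H_x × H_y with ‖x_n‖ ≤ C_x and ‖y_n‖ ≤ C_y almost surely. Then the Rademacher complexity of the induced loss class satisfies R_N(L∘T_p) ≤ C_y²/√N + N^{−min(1/2, 1/p)}·(B² C_x² + 2 B C_x C_y). -/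
open MeasureTheory
open scoped InnerProductSpace ENNReal NNReal

/-- The `n`-th approximation number of a bounded operator between complex Hilbert spaces,
`a_n(T) = inf { ‖T - A‖ : rank A ≤ n }` (indexed from `n = 0`).  For a compact operator on
Hilbert spaces this equals the `(n+1)`-st singular value `s_{n+1}(T)`, i.e. the `(n+1)`-st
eigenvalue of `|T| = (T*T)^{1/2}` in non-increasing order. -/
noncomputable def approxNumber {E F : Type*} [NormedAddCommGroup E] [NormedSpace ℂ E]
    [NormedAddCommGroup F] [NormedSpace ℂ F] (T : E →L[ℂ] F) (n : ℕ) : ℝ :=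
  sInf {r : ℝ | ∃ A : E →L[ℂ] F, LinearMap.rank (A : E →ₗ[ℂ] F) ≤ (n : Cardinal) ∧ r = ‖T - A‖}

/-- The Schatten `p`-norm `‖T‖_{S_p} = (∑_k s_k(T)^p)^{1/p}`. -/
noncomputable def schattenNorm {E F : Type*} [NormedAddCommGroup E] [NormedSpace ℂ E]
    [NormedAddCommGroup F] [NormedSpace ℂ F] (p : ℝ) (T : E →L[ℂ] F) : ℝ :=
  (∑' n : ℕ, approxNumber T n ^ p) ^ (1 / p)

/-- `T` belongs to the `p`-Schatten–von Neumann class `S_p`: `T` is compact and its singular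
values are `ℓ^p`-summable. -/
def MemSchatten {E F : Type*} [NormedAddCommGroup E] [NormedSpace ℂ E]
    [NormedAddCommGroup F] [NormedSpace ℂ F] (p : ℝ) (T : E →L[ℂ] F) : Prop :=
  IsCompactOperator T ∧ Summable fun n : ℕ => approxNumber T n ^ p

/-- The Rademacher distribution on `ℝ`, uniform on `{-1, +1}`. -/
noncomputable def rademacherMeasure : Measure ℝ :=
  (2⁻¹ : ℝ≥0∞) • Measure.dirac 1 + (2⁻¹ : ℝ≥0∞) • Measure.dirac (-1)

instance : IsProbabilityMeasure rademacherMeasure := by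
  constructor
  simp [rademacherMeasure, ENNReal.inv_two_add_inv_two]


section ApproxNumber

variable {E F : Type*} [NormedAddCommGroup E] [NormedSpace ℂ E]
    [NormedAddCommGroup F] [NormedSpace ℂ F]

lemma approxNumber_nonneg (T : E →L[ℂ] F) (n : ℕ) : 0 ≤ approxNumber T n := by
  apply Real.sInf_nonneg
  rintro r ⟨A, -, rfl⟩
  exact norm_nonneg _

lemma le_approxNumber (T : E →L[ℂ] F) (n : ℕ) {c : ℝ}
    (h : ∀ A : E →L[ℂ] F, LinearMap.rank (A : E →ₗ[ℂ] F) ≤ (n : Cardinal) → c ≤ ‖T - A‖) :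
    c ≤ approxNumber T n := by
  refine le_csInf ⟨‖T - 0‖, 0, by simp, rfl⟩ ?_
  rintro r ⟨A, hA, rfl⟩
  exact h A hA

lemma norm_le_approxNumber_zero (T : E →L[ℂ] F) : ‖T‖ ≤ approxNumber T 0 := by
  refine le_approxNumber T 0 fun A hA => ?_
  have h0 : (A : E →ₗ[ℂ] F) = 0 := by
    rw [← LinearMap.range_eq_bot, ← Submodule.rank_eq_zero]
    simpa [LinearMap.rank] using hA
  have hA0 : A = 0 := ContinuousLinearMap.coe_injective h0
  simp [hA0]

lemma sum_approxNumber_rpow_le {p B : ℝ} (hp : 1 ≤ p) {T : E →L[ℂ] F}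
    (hT : MemSchatten p T) (hB : schattenNorm p T ≤ B) (s : Finset ℕ) :
    ∑ n ∈ s, approxNumber T n ^ p ≤ B ^ p := by
  have hp0 : 0 < p := by linarith
  have h0 : ∀ n, 0 ≤ approxNumber T n ^ p := fun n => Real.rpow_nonneg (approxNumber_nonneg T n) p
  refine (hT.2.sum_le_tsum s fun n _ => h0 n).trans ?_
  have h1 := Real.rpow_le_rpow (Real.rpow_nonneg (tsum_nonneg h0) _) hB hp0.le
  rwa [← Real.rpow_mul (tsum_nonneg h0), one_div, inv_mul_cancel₀ hp0.ne', Real.rpow_one] at h1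

lemma approxNumber_le_of_schattenNorm_le {p B : ℝ} (hp : 1 ≤ p) (hB0 : 0 ≤ B) {T : E →L[ℂ] F}
    (hT : MemSchatten p T) (hB : schattenNorm p T ≤ B) (n : ℕ) : approxNumber T n ≤ B := by
  have h := sum_approxNumber_rpow_le hp hT hB {n}
  rw [Finset.sum_singleton] at h
  exact (Real.rpow_le_rpow_iff (approxNumber_nonneg T n) hB0 (by linarith)).1 h

lemma sum_approxNumber_sq_le {p B : ℝ} (hp : 1 ≤ p) (hB0 : 0 < B) {T : E →L[ℂ] F}
    (hT : MemSchatten p T) (hB : schattenNorm p T ≤ B) {d N : ℕ} (hN : 0 < N) (hd : d ≤ N) :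
    ∑ k ∈ Finset.range d, approxNumber T k ^ 2 ≤
      (B * (N : ℝ) ^ (1 / 2 - min (1 / 2 : ℝ) (1 / p))) ^ 2 := by
  have hp0 : 0 < p := by linarith
  have hN0 : (0 : ℝ) < N := by exact_mod_cast hN
  have ha := approxNumber_nonneg T
  rcases le_total p 2 with h2 | h2
  · have hmin : min (1 / 2 : ℝ) (1 / p) = 1 / 2 :=
      min_eq_left (one_div_le_one_div_of_le hp0 h2)
    rw [hmin, sub_self, Real.rpow_zero, mul_one]
    calc ∑ k ∈ Finset.range d, approxNumber T k ^ 2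
        ≤ ∑ k ∈ Finset.range d, approxNumber T k ^ p * B ^ (2 - p) := by
          refine Finset.sum_le_sum fun k _ => ?_
          have h3 : approxNumber T k ^ 2 = approxNumber T k ^ p * approxNumber T k ^ (2 - p) := by
            rw [← Real.rpow_add_of_nonneg (ha k) hp0.le (by linarith)]
            norm_num
          rw [h3]
          exact mul_le_mul_of_nonneg_left (Real.rpow_le_rpow (ha k)
            (approxNumber_le_of_schattenNorm_le hp hB0.le hT hB k) (by linarith))
            (Real.rpow_nonneg (ha k) _)
      _ = (∑ k ∈ Finset.range d, approxNumber T k ^ p) * B ^ (2 - p) := by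
          rw [Finset.sum_mul]
      _ ≤ B ^ p * B ^ (2 - p) :=
          mul_le_mul_of_nonneg_right (sum_approxNumber_rpow_le hp hT hB _)
            (Real.rpow_nonneg hB0.le _)
      _ = B ^ 2 := by
          rw [← Real.rpow_add hB0]
          norm_num
  · have hmin : min (1 / 2 : ℝ) (1 / p) = 1 / p :=
      min_eq_right (one_div_le_one_div_of_le two_pos h2)
    rw [hmin]
    have hq : 1 ≤ p / 2 := by linarith
    have hq0 : 0 < p / 2 := by linarith
    have hs : 0 ≤ ∑ k ∈ Finset.range d, approxNumber T k ^ 2 :=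
      Finset.sum_nonneg fun k _ => sq_nonneg _
    rw [← Real.rpow_le_rpow_iff hs (sq_nonneg _) hq0]
    calc (∑ k ∈ Finset.range d, approxNumber T k ^ 2) ^ (p / 2)
        ≤ ((Finset.range d).card : ℝ) ^ (p / 2 - 1) *
            ∑ k ∈ Finset.range d, (approxNumber T k ^ 2) ^ (p / 2) :=
          Real.rpow_sum_le_const_mul_sum_rpow_of_nonneg _ hq fun k _ => sq_nonneg _
      _ = (d : ℝ) ^ (p / 2 - 1) * ∑ k ∈ Finset.range d, approxNumber T k ^ p := by
          rw [Finset.card_range]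
          congr 1
          refine Finset.sum_congr rfl fun k _ => ?_
          rw [← Real.rpow_natCast, ← Real.rpow_mul (ha k)]
          congr 1
          push_cast
          ring
      _ ≤ (N : ℝ) ^ (p / 2 - 1) * B ^ p := by
          refine mul_le_mul (Real.rpow_le_rpow (by positivity) (by exact_mod_cast hd)
            (by linarith)) (sum_approxNumber_rpow_le hp hT hB _)
            (Finset.sum_nonneg fun k _ => Real.rpow_nonneg (ha k) _) (by positivity)
      _ = ((B * (N : ℝ) ^ (1 / 2 - 1 / p)) ^ 2) ^ (p / 2) := by
          rw [← Real.rpow_natCast, ← Real.rpow_mul (by positivity),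
            Real.mul_rpow hB0.le (by positivity), ← Real.rpow_mul hN0.le, mul_comm]
          congr 2
          · push_cast; ring
          · push_cast; field_simp

end ApproxNumber

lemma exists_orthonormalBasis_norm_le_approxNumber {E F : Type*}
    [NormedAddCommGroup E] [InnerProductSpace ℂ E]
    [NormedAddCommGroup F] [InnerProductSpace ℂ F] [CompleteSpace F]
    (T : E →L[ℂ] F) (V : Submodule ℂ E) [FiniteDimensional ℂ V] :
    ∃ b : OrthonormalBasis (Fin (Module.finrank ℂ V)) ℂ V,
      ∀ i, ‖T (b i)‖ ≤ approxNumber T i := by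
  have : CompleteSpace V := FiniteDimensional.complete ℂ V
  set S : V →L[ℂ] F := T ∘L V.subtypeL with hS
  set M : V →ₗ[ℂ] V := ((ContinuousLinearMap.adjoint S ∘L S : V →L[ℂ] V) : V →ₗ[ℂ] V) with hM
  have hMi : ∀ u w : V, ⟪u, M w⟫_ℂ = ⟪S u, S w⟫_ℂ := fun u w =>
    ContinuousLinearMap.adjoint_inner_right S u (S w)
  have hsymm : M.IsSymmetric := fun u w => by
    rw [hMi, ← inner_conj_symm, hMi, inner_conj_symm]
  set b := hsymm.eigenvectorBasis rfl with hb
  set lam := hsymm.eigenvalues rfl with hlam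
  have hSu : ∀ u : V, ‖S u‖ ^ 2 = ∑ j, lam j * ‖b.repr u j‖ ^ 2 := fun u => by
    have h1 : ⟪u, M u⟫_ℂ = ((∑ j, lam j * ‖b.repr u j‖ ^ 2 : ℝ) : ℂ) := by
      rw [← b.sum_inner_mul_inner u (M u)]
      push_cast
      refine Finset.sum_congr rfl fun j _ => ?_
      rw [← inner_conj_symm u, ← b.repr_apply_apply, ← b.repr_apply_apply, hb,
        hsymm.eigenvectorBasis_apply_self_apply, ← Complex.conj_mul']
      exact mul_left_comm _ _ _
    rw [hMi, inner_self_eq_norm_sq_to_K] at h1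
    have h2 : ((‖S u‖ ^ 2 : ℝ) : ℂ) = ((∑ j, lam j * ‖b.repr u j‖ ^ 2 : ℝ) : ℂ) := by
      rw [← h1]
      push_cast
      rfl
    exact Complex.ofReal_injective h2
  have hTb : ∀ i, ‖T (b i)‖ ^ 2 = lam i := fun i => by
    have h := hSu (b i)
    simpa [hS, Pi.single_apply, apply_ite] using h
  refine ⟨b, fun i => le_approxNumber T i fun A hA => ?_⟩
  let g : (Fin (i + 1) → ℂ) →ₗ[ℂ] V := Fintype.linearCombination ℂ fun j => b (Fin.castLE i.isLt j)
  have hg : ∀ c, g c = ∑ j, c j • b (Fin.castLE i.isLt j) := fun c => rfl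
  have hg_inj : Function.Injective g := by
    exact linearIndependent_iff_injective_fintypeLinearCombination.1
      (b.orthonormal.linearIndependent.comp (Fin.castLE i.isLt) (Fin.castLE_injective _))
  have hker : ∃ c, c ≠ 0 ∧ A (g c) = 0 := by
    by_contra! hcon
    let L : (Fin (i + 1) → ℂ) →ₗ[ℂ] F := (A : E →ₗ[ℂ] F) ∘ₗ (V.subtype ∘ₗ g)
    have hL : Function.Injective L := by
      rw [← LinearMap.ker_eq_bot, LinearMap.ker_eq_bot']
      intro c hc
      by_contra hne
      exact hcon c hne hc
    have h1 := LinearMap.rank_comp_le_left (V.subtype ∘ₗ g) (A : E →ₗ[ℂ] F)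
    have h2 : Module.finrank ℂ (LinearMap.range L) = i + 1 := by
      rw [LinearMap.finrank_range_of_inj hL, Module.finrank_fin_fun]
    have h3 : LinearMap.rank L = ((i + 1 : ℕ) : Cardinal) := by
      rw [LinearMap.rank, ← Module.finrank_eq_rank, h2]
    have h4 : ((i + 1 : ℕ) : Cardinal) ≤ ((i : ℕ) : Cardinal) := h3 ▸ h1.trans hA
    exact absurd (Nat.cast_le.1 h4) (by omega)
  obtain ⟨c, hc, hAc⟩ := hker
  have hu : g c ≠ 0 := fun h => hc (hg_inj (by rw [h, map_zero]))
  have hrepr : ∀ j, i < j → b.repr (g c) j = 0 := fun j hj => by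
    rw [hg, b.repr_apply_apply, inner_sum]
    refine Finset.sum_eq_zero fun k _ => ?_
    have hne : j ≠ Fin.castLE i.isLt k := by
      intro h
      have h5 : (j : ℕ) = k := by rw [h]; rfl
      have h6 : (i : ℕ) < j := hj
      omega
    rw [inner_smul_right, b.orthonormal.2 hne, mul_zero]
  have h1 : (‖T (b i)‖ * ‖g c‖) ^ 2 ≤ ‖S (g c)‖ ^ 2 := by
    rw [mul_pow, hTb, hSu, ← b.repr.norm_map (g c), EuclideanSpace.norm_sq_eq, Finset.mul_sum]
    refine Finset.sum_le_sum fun j _ => ?_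
    rcases le_or_gt j i with hj | hj
    · exact mul_le_mul_of_nonneg_right (hsymm.eigenvalues_antitone rfl hj) (sq_nonneg _)
    · simp [hrepr j hj]
  have h2 : ‖S (g c)‖ ≤ ‖T - A‖ * ‖g c‖ := by
    have h3 : S (g c) = (T - A) (g c) := by simp [hS, hAc]
    rw [h3]
    exact (T - A).le_opNorm _
  exact le_of_mul_le_mul_right (((pow_le_pow_iff_left₀ (by positivity) (norm_nonneg _)
    two_ne_zero).1 h1).trans h2) (norm_pos_iff.2 hu)

/-- The squared Hilbert–Schmidt norm of the operator `∑ n, σ n • (z n ⊗ x n)`, as a Gram sum. -/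
noncomputable def signedGram {E F : Type*} [NormedAddCommGroup E] [InnerProductSpace ℂ E]
    [NormedAddCommGroup F] [InnerProductSpace ℂ F] {N : ℕ} (x : Fin N → E) (z : Fin N → F)
    (σ : Fin N → ℝ) : ℝ :=
  ∑ n, ∑ m, σ n * σ m * RCLike.re (⟪x m, x n⟫_ℂ * ⟪z n, z m⟫_ℂ)

section Gram

variable {E F : Type*} [NormedAddCommGroup E] [InnerProductSpace ℂ E]
    [NormedAddCommGroup F] [InnerProductSpace ℂ F] {N : ℕ}

lemma sum_norm_sq_eq_signedGram {ι : Type*} [Fintype ι] {V : Submodule ℂ E}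
    (b : OrthonormalBasis ι ℂ V) (x : Fin N → V) (z : Fin N → F) (σ : Fin N → ℝ) :
    ∑ i, ‖∑ n, ((σ n : ℂ) * ⟪x n, b i⟫_ℂ) • z n‖ ^ 2 = signedGram (fun n => (x n : E)) z σ := by
  have h : ∀ i, ‖∑ n, ((σ n : ℂ) * ⟪x n, b i⟫_ℂ) • z n‖ ^ 2 =
      RCLike.re (∑ n, ∑ m, (σ n : ℂ) * (σ m : ℂ) *
        ((⟪x m, b i⟫_ℂ * ⟪b i, x n⟫_ℂ) * ⟪z n, z m⟫_ℂ)) := fun i => by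
    rw [← inner_self_eq_norm_sq (𝕜 := ℂ), sum_inner]
    congr 1
    refine Finset.sum_congr rfl fun n _ => ?_
    rw [inner_sum]
    refine Finset.sum_congr rfl fun m _ => ?_
    rw [inner_smul_left, inner_smul_right, map_mul, inner_conj_symm, Complex.conj_ofReal]
    ring
  simp_rw [h]
  rw [← map_sum, Finset.sum_comm, map_sum, signedGram]
  refine Finset.sum_congr rfl fun n _ => ?_
  rw [Finset.sum_comm, map_sum]
  refine Finset.sum_congr rfl fun m _ => ?_
  rw [← Finset.mul_sum, ← Finset.sum_mul, b.sum_inner_mul_inner, ← Complex.ofReal_mul]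
  exact Complex.re_ofReal_mul _ _

lemma abs_sum_re_inner_le {ι : Type*} [Fintype ι] {V : Submodule ℂ E}
    (b : OrthonormalBasis ι ℂ V) (x : Fin N → V) (z : Fin N → F) (σ : Fin N → ℝ)
    (T : E →L[ℂ] F) :
    |∑ n, σ n * RCLike.re ⟪z n, T (x n)⟫_ℂ| ≤
      √(∑ i, ‖T (b i)‖ ^ 2) * √(∑ i, ‖∑ n, ((σ n : ℂ) * ⟪x n, b i⟫_ℂ) • z n‖ ^ 2) := by
  have h : ∑ n, σ n * RCLike.re ⟪z n, T (x n)⟫_ℂ =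
      RCLike.re (∑ i, ⟪∑ n, ((σ n : ℂ) * ⟪x n, b i⟫_ℂ) • z n, T (b i)⟫_ℂ) := by
    simp_rw [sum_inner]
    rw [Finset.sum_comm, map_sum]
    refine Finset.sum_congr rfl fun n _ => ?_
    have hx : (x n : E) = ∑ i, ⟪b i, x n⟫_ℂ • (b i : E) := by
      conv_lhs => rw [← b.sum_repr' (x n)]
      simp
    rw [hx, map_sum, inner_sum]
    simp_rw [map_smul, inner_smul_right, inner_smul_left, map_mul, inner_conj_symm,
      Complex.conj_ofReal, mul_assoc]
    rw [← Finset.mul_sum]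
    exact (Complex.re_ofReal_mul _ _).symm
  rw [h]
  refine (RCLike.abs_re_le_norm _).trans ((norm_sum_le _ _).trans ?_)
  refine (Finset.sum_le_sum fun i _ => norm_inner_le_norm _ _).trans ?_
  rw [mul_comm]
  exact Real.sum_mul_le_sqrt_mul_sqrt _ _ _

lemma signedGram_nonneg (x : Fin N → E) (z : Fin N → F) (σ : Fin N → ℝ) :
    0 ≤ signedGram x z σ := by
  let V : Submodule ℂ E := Submodule.span ℂ (Set.range x)
  have : FiniteDimensional ℂ V := FiniteDimensional.span_of_finite ℂ (Set.finite_range x)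
  have h := sum_norm_sq_eq_signedGram (stdOrthonormalBasis ℂ V)
    (fun n => ⟨x n, Submodule.subset_span ⟨n, rfl⟩⟩) z σ
  change _ = signedGram x z σ at h
  rw [← h]
  exact Finset.sum_nonneg fun i _ => sq_nonneg _

variable [CompleteSpace F]

lemma exists_orthonormalBasis_sum_norm_sq_le {p B : ℝ} (hp : 1 ≤ p) (hB0 : 0 < B) {T : E →L[ℂ] F}
    (hT : MemSchatten p T) (hB : schattenNorm p T ≤ B) (hN : 0 < N)
    (V : Submodule ℂ E) [FiniteDimensional ℂ V] (hV : Module.finrank ℂ V ≤ N) :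
    ∃ b : OrthonormalBasis (Fin (Module.finrank ℂ V)) ℂ V,
      √(∑ i, ‖T (b i)‖ ^ 2) ≤ B * (N : ℝ) ^ (1 / 2 - min (1 / 2 : ℝ) (1 / p)) := by
  obtain ⟨b, hb⟩ := exists_orthonormalBasis_norm_le_approxNumber T V
  refine ⟨b, (Real.sqrt_le_left (by positivity)).2 ?_⟩
  refine le_trans ?_ (sum_approxNumber_sq_le hp hB0 hT hB hN hV)
  rw [← Fin.sum_univ_eq_sum_range fun k => approxNumber T k ^ 2]
  exact Finset.sum_le_sum fun i _ => pow_le_pow_left₀ (norm_nonneg _) (hb i) 2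

lemma abs_signed_loss_le {p B : ℝ} (hp : 1 ≤ p) (hB0 : 0 < B) {T : E →L[ℂ] F}
    (hT : MemSchatten p T) (hB : schattenNorm p T ≤ B) (hN : 0 < N)
    (x : Fin N → E) (y : Fin N → F) (σ : Fin N → ℝ) :
    |∑ n, σ n * ‖y n - T (x n)‖ ^ 2| ≤
      |∑ n, σ n * ‖y n‖ ^ 2| +
      B * (N : ℝ) ^ (1 / 2 - min (1 / 2 : ℝ) (1 / p)) *
        (2 * √(signedGram x y σ) + B * √(signedGram x x σ)) := by
  set K := B * (N : ℝ) ^ (1 / 2 - min (1 / 2 : ℝ) (1 / p)) with hK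
  have hK0 : 0 ≤ K := by positivity
  let V : Submodule ℂ E := Submodule.span ℂ (Set.range x)
  have : FiniteDimensional ℂ V := FiniteDimensional.span_of_finite ℂ (Set.finite_range x)
  have hV : Module.finrank ℂ V ≤ N :=
    (finrank_range_le_card (R := ℂ) x).trans_eq (Fintype.card_fin N)
  obtain ⟨b, hb⟩ := exists_orthonormalBasis_sum_norm_sq_le hp hB0 hT hB hN V hV
  let x' : Fin N → V := fun n => ⟨x n, Submodule.subset_span ⟨n, rfl⟩⟩
  have hnorm : ‖T‖ ≤ B :=
    (norm_le_approxNumber_zero T).trans (approxNumber_le_of_schattenNorm_le hp hB0.le hT hB 0)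
  have hcross : |∑ n, σ n * RCLike.re ⟪y n, T (x n)⟫_ℂ| ≤ K * √(signedGram x y σ) := by
    refine (abs_sum_re_inner_le b x' y σ T).trans ?_
    rw [sum_norm_sq_eq_signedGram]
    exact mul_le_mul_of_nonneg_right hb (Real.sqrt_nonneg _)
  have hsq : |∑ n, σ n * RCLike.re ⟪T (x n), T (x n)⟫_ℂ| ≤ K * (B * √(signedGram x x σ)) := by
    refine (abs_sum_re_inner_le b x' (fun n => T (x n)) σ T).trans ?_
    refine mul_le_mul hb ?_ (Real.sqrt_nonneg _) hK0
    rw [← Real.sqrt_sq hB0.le, ← Real.sqrt_mul (sq_nonneg B)]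
    refine Real.sqrt_le_sqrt ?_
    have hG := sum_norm_sq_eq_signedGram b x' x σ
    change _ = signedGram x x σ at hG
    rw [← hG, Finset.mul_sum]
    refine Finset.sum_le_sum fun i _ => ?_
    rw [← mul_pow]
    refine pow_le_pow_left₀ (norm_nonneg _) ?_ 2
    simp_rw [← map_smul]
    rw [← map_sum]
    exact T.le_of_opNorm_le hnorm _
  have hexp : ∑ n, σ n * ‖y n - T (x n)‖ ^ 2 = ∑ n, σ n * ‖y n‖ ^ 2
      - 2 * ∑ n, σ n * RCLike.re ⟪y n, T (x n)⟫_ℂ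
      + ∑ n, σ n * RCLike.re ⟪T (x n), T (x n)⟫_ℂ := by
    rw [Finset.mul_sum, ← Finset.sum_sub_distrib, ← Finset.sum_add_distrib]
    refine Finset.sum_congr rfl fun n _ => ?_
    rw [@norm_sub_sq ℂ, inner_self_eq_norm_sq]
    ring
  rw [hexp]
  rw [abs_le] at hcross hsq ⊢
  have h1 := abs_le.1 (le_refl |∑ n, σ n * ‖y n‖ ^ 2|)
  constructor <;> nlinarith [h1.1, h1.2, hcross.1, hcross.2, hsq.1, hsq.2]

end Gram

section Rademacher

lemma integrable_rademacherMeasure (f : ℝ → ℝ) : Integrable f rademacherMeasure := by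
  have h : ∀ a : ℝ, Integrable f ((2⁻¹ : ℝ≥0∞) • Measure.dirac a) := fun a =>
    (integrable_dirac enorm_lt_top).smul_measure (by simp)
  exact (h 1).add_measure (h (-1))

lemma integral_rademacherMeasure (f : ℝ → ℝ) :
    ∫ s, f s ∂rademacherMeasure = (f 1 + f (-1)) / 2 := by
  have h : ∀ a : ℝ, Integrable f ((2⁻¹ : ℝ≥0∞) • Measure.dirac a) := fun a =>
    (integrable_dirac enorm_lt_top).smul_measure (by simp)
  rw [rademacherMeasure, integral_add_measure (h 1) (h (-1))]
  simp only [integral_smul_measure, integral_dirac, ENNReal.toReal_inv, ENNReal.toReal_ofNat,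
    smul_eq_mul]
  ring

variable {N : ℕ}

lemma mul_eq_prod_ite_mul_ite (σ : Fin N → ℝ) (n m : Fin N) :
    σ n * σ m = ∏ i, ((if i = n then σ i else 1) * (if i = m then σ i else 1)) := by
  rw [Finset.prod_mul_distrib]
  simp

lemma integrable_mul_rademacher (n m : Fin N) :
    Integrable (fun σ : Fin N → ℝ => σ n * σ m) (Measure.pi fun _ => rademacherMeasure) := by
  simp_rw [mul_eq_prod_ite_mul_ite]
  exact Integrable.fintype_prod
    (f := fun i s => (if i = n then s else 1) * (if i = m then s else 1))
    fun i => integrable_rademacherMeasure _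

lemma integral_mul_rademacher (n m : Fin N) :
    ∫ σ : Fin N → ℝ, σ n * σ m ∂(Measure.pi fun _ => rademacherMeasure) =
      if n = m then 1 else 0 := by
  simp_rw [mul_eq_prod_ite_mul_ite]
  rw [integral_fintype_prod_eq_prod
    (f := fun i s => (if i = n then s else 1) * (if i = m then s else 1))]
  simp_rw [integral_rademacherMeasure]
  split_ifs with h
  · subst h
    refine Finset.prod_eq_one fun i _ => ?_
    split_ifs <;> norm_num
  · refine Finset.prod_eq_zero (Finset.mem_univ n) ?_
    simp [h]

lemma sqrt_le_half_add {s a : ℝ} (hs : 0 ≤ s) (ha : 0 < a) : √s ≤ (s / a + a) / 2 := by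
  have h : √s * a ≤ (s + a * a) / 2 := by
    nlinarith [sq_nonneg (√s - a), Real.sq_sqrt hs]
  rw [← le_div_iff₀ ha] at h
  refine h.trans_eq ?_
  field_simp

/-- Jensen's inequality for a nonnegative quadratic form in Rademacher variables. -/
lemma integrable_sqrt_quadraticForm_and_integral_le (c : Fin N → Fin N → ℝ)
    (hc : ∀ σ : Fin N → ℝ, 0 ≤ ∑ n, ∑ m, σ n * σ m * c n m) {a : ℝ} (ha : 0 < a)
    (hca : ∑ n, c n n ≤ a ^ 2) :
    Integrable (fun σ : Fin N → ℝ => √(∑ n, ∑ m, σ n * σ m * c n m))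
        (Measure.pi fun _ => rademacherMeasure) ∧
      ∫ σ : Fin N → ℝ, √(∑ n, ∑ m, σ n * σ m * c n m)
        ∂(Measure.pi fun _ => rademacherMeasure) ≤ a := by
  have hint : Integrable (fun σ : Fin N → ℝ => ∑ n, ∑ m, σ n * σ m * c n m)
      (Measure.pi fun _ => rademacherMeasure) :=
    integrable_finsetSum _ fun n _ => integrable_finsetSum _ fun m _ =>
      (integrable_mul_rademacher n m).mul_const _
  have hval : ∫ σ : Fin N → ℝ, ∑ n, ∑ m, σ n * σ m * c n m
      ∂(Measure.pi fun _ => rademacherMeasure) = ∑ n, c n n := by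
    rw [integral_finsetSum _ fun n _ => integrable_finsetSum _ fun m _ =>
      (integrable_mul_rademacher n m).mul_const _]
    refine Finset.sum_congr rfl fun n _ => ?_
    rw [integral_finsetSum _ fun m _ => (integrable_mul_rademacher n m).mul_const _]
    simp_rw [integral_mul_const, integral_mul_rademacher]
    simp
  have hint' : Integrable (fun σ : Fin N → ℝ => ((∑ n, ∑ m, σ n * σ m * c n m) / a + a) / 2)
      (Measure.pi fun _ => rademacherMeasure) :=
    ((hint.div_const a).add (integrable_const a)).div_const 2
  have hle : ∀ σ : Fin N → ℝ, √(∑ n, ∑ m, σ n * σ m * c n m) ≤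
      ((∑ n, ∑ m, σ n * σ m * c n m) / a + a) / 2 := fun σ => sqrt_le_half_add (hc σ) ha
  have hsqrt : Integrable (fun σ : Fin N → ℝ => √(∑ n, ∑ m, σ n * σ m * c n m))
      (Measure.pi fun _ => rademacherMeasure) := by
    refine hint'.mono' (by fun_prop) (Filter.Eventually.of_forall fun σ => ?_)
    rw [Real.norm_of_nonneg (Real.sqrt_nonneg _)]
    exact hle σ
  refine ⟨hsqrt, (integral_mono hsqrt hint' hle).trans ?_⟩
  rw [integral_div, integral_add (hint.div_const a) (integrable_const a), integral_div, hval]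
  simp only [integral_const, probReal_univ, one_smul]
  have h : (∑ n, c n n) / a ≤ a := by
    rw [div_le_iff₀ ha, ← sq]
    exact hca
  linarith

lemma integrable_abs_sum_and_integral_le (t : Fin N → ℝ) {C : ℝ} (hC : 0 < C) (hN : 0 < N)
    (ht : ∀ n, |t n| ≤ C) :
    Integrable (fun σ : Fin N → ℝ => |∑ n, σ n * t n|)
        (Measure.pi fun _ => rademacherMeasure) ∧
      ∫ σ : Fin N → ℝ, |∑ n, σ n * t n| ∂(Measure.pi fun _ => rademacherMeasure) ≤
        C * √N := by
  have hN0 : (0 : ℝ) < N := by exact_mod_cast hN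
  have hsq : ∀ σ : Fin N → ℝ, ∑ n, ∑ m, σ n * σ m * (t n * t m) = (∑ n, σ n * t n) ^ 2 :=
    fun σ => by
      rw [sq, Finset.sum_mul_sum]
      exact Finset.sum_congr rfl fun n _ => Finset.sum_congr rfl fun m _ => by ring
  have h := integrable_sqrt_quadraticForm_and_integral_le (fun n m => t n * t m)
    (fun σ => (hsq σ).symm ▸ sq_nonneg _) (a := C * √N) (by positivity) (by
      rw [mul_pow, Real.sq_sqrt hN0.le]
      calc ∑ n, t n * t n ≤ ∑ _n : Fin N, C ^ 2 :=
            Finset.sum_le_sum fun n _ => by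
              rw [← sq, ← sq_abs]
              exact pow_le_pow_left₀ (abs_nonneg _) (ht n) 2
        _ = C ^ 2 * N := by simp [mul_comm])
  simpa only [hsq, Real.sqrt_sq_eq_abs] using h

lemma integrable_sqrt_signedGram_and_integral_le {E F : Type*}
    [NormedAddCommGroup E] [InnerProductSpace ℂ E]
    [NormedAddCommGroup F] [InnerProductSpace ℂ F] (x : Fin N → E) (z : Fin N → F)
    {C D : ℝ} (hC : 0 < C) (hD : 0 < D) (hN : 0 < N)
    (hx : ∀ n, ‖x n‖ ≤ C) (hz : ∀ n, ‖z n‖ ≤ D) :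
    Integrable (fun σ => √(signedGram x z σ)) (Measure.pi fun _ => rademacherMeasure) ∧
      ∫ σ, √(signedGram x z σ) ∂(Measure.pi fun _ => rademacherMeasure) ≤ C * D * √N := by
  have hN0 : (0 : ℝ) < N := by exact_mod_cast hN
  refine integrable_sqrt_quadraticForm_and_integral_le _ (signedGram_nonneg x z)
    (a := C * D * √N) (by positivity) ?_
  rw [mul_pow, Real.sq_sqrt hN0.le]
  calc ∑ n, RCLike.re (⟪x n, x n⟫_ℂ * ⟪z n, z n⟫_ℂ) ≤ ∑ _n : Fin N, (C * D) ^ 2 :=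
        Finset.sum_le_sum fun n _ => by
          refine (RCLike.re_le_norm _).trans ?_
          rw [norm_mul, inner_self_eq_norm_sq_to_K, inner_self_eq_norm_sq_to_K, ← norm_mul,
            ← mul_pow, norm_pow, norm_mul, RCLike.norm_ofReal, RCLike.norm_ofReal, abs_norm,
            abs_norm]
          exact pow_le_pow_left₀ (by positivity)
            (mul_le_mul (hx n) (hz n) (norm_nonneg _) hC.le) 2
    _ = (C * D) ^ 2 * N := by simp [mul_comm]

end Rademacher

/-- Vanishing Rademacher complexity.
For `N` i.i.d. samples from `P` (with `‖x‖ ≤ C_x`, `‖y‖ ≤ C_y` a.s.) and i.i.d. Rademacher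
signs, the Rademacher complexity of the loss class induced by
`T_p = {T ∈ S_p : ‖T‖_{S_p} ≤ B}` satisfies
`R_N(L ∘ T_p) ≤ C_y²/√N + N^{-min(1/2,1/p)} (B² C_x² + 2 B C_x C_y)`. -/
theorem statement2
    {Hx Hy : Type*} [NormedAddCommGroup Hx] [InnerProductSpace ℂ Hx] [CompleteSpace Hx]
    [NormedAddCommGroup Hy] [InnerProductSpace ℂ Hy] [CompleteSpace Hy]
    [MeasurableSpace Hx] [BorelSpace Hx] [MeasurableSpace Hy] [BorelSpace Hy]
    (p : ℝ) (hp : 1 ≤ p) (B : ℝ) (hB : 0 < B)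
    (P : Measure (Hx × Hy)) [IsProbabilityMeasure P]
    (Cx Cy : ℝ) (hCx : 0 < Cx) (hCy : 0 < Cy)
    (hbound : ∀ᵐ z ∂P, ‖z.1‖ ≤ Cx ∧ ‖z.2‖ ≤ Cy)
    (N : ℕ) (hN : 0 < N) :
    (∫ v, (∫ σ,
        (⨆ T : {T : Hx →L[ℂ] Hy // MemSchatten p T ∧ schattenNorm p T ≤ B},
          |(N : ℝ)⁻¹ * ∑ n, σ n * ‖(v n).2 - (T : Hx →L[ℂ] Hy) (v n).1‖ ^ 2|)
        ∂(Measure.pi fun _ : Fin N => rademacherMeasure))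
      ∂(Measure.pi fun _ : Fin N => P)) ≤
      Cy ^ 2 / Real.sqrt N +
        (N : ℝ) ^ (-(min (1 / 2 : ℝ) (1 / p))) * (B ^ 2 * Cx ^ 2 + 2 * B * Cx * Cy) := by
  have hN0 : (0 : ℝ) < N := by exact_mod_cast hN
  set K := B * (N : ℝ) ^ (1 / 2 - min (1 / 2 : ℝ) (1 / p)) with hK
  have hK0 : 0 ≤ K := by positivity
  have hrhs : Cy ^ 2 / Real.sqrt N +
      (N : ℝ) ^ (-(min (1 / 2 : ℝ) (1 / p))) * (B ^ 2 * Cx ^ 2 + 2 * B * Cx * Cy) =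
      (N : ℝ)⁻¹ * (Cy ^ 2 * √N + K * (2 * (Cx * Cy * √N) + B * (Cx * Cx * √N))) := by
    have h1 : (N : ℝ)⁻¹ * √N = 1 / √N := by
      field_simp
      rw [Real.sq_sqrt hN0.le]
    have h2 : (N : ℝ) ^ (-(min (1 / 2 : ℝ) (1 / p))) =
        (N : ℝ)⁻¹ * √N * (N : ℝ) ^ (1 / 2 - min (1 / 2 : ℝ) (1 / p)) := by
      rw [Real.sqrt_eq_rpow, ← Real.rpow_neg_one, ← Real.rpow_add hN0, ← Real.rpow_add hN0]
      congr 1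
      ring
    rw [h2, hK, div_eq_mul_one_div (Cy ^ 2), ← h1]
    ring
  have hv : ∀ᵐ v ∂(Measure.pi fun _ : Fin N => P), ∀ n, ‖(v n).1‖ ≤ Cx ∧ ‖(v n).2‖ ≤ Cy :=
    ae_all_iff.2 fun n => (Measure.tendsto_eval_ae_ae (μ := fun _ : Fin N => P) (i := n)).eventually hbound
  have hsup : ∀ (v : Fin N → Hx × Hy) (σ : Fin N → ℝ),
      0 ≤ ⨆ T : {T : Hx →L[ℂ] Hy // MemSchatten p T ∧ schattenNorm p T ≤ B},
        |(N : ℝ)⁻¹ * ∑ n, σ n * ‖(v n).2 - (T : Hx →L[ℂ] Hy) (v n).1‖ ^ 2| :=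
    fun v σ => Real.iSup_nonneg fun T => abs_nonneg _
  rw [hrhs]
  refine (integral_mono_of_nonneg (Filter.Eventually.of_forall fun v =>
    integral_nonneg (hsup v)) (integrable_const _) ?_).trans_eq
    (by rw [integral_const, probReal_univ, one_smul])
  filter_upwards [hv] with v hv
  obtain ⟨hi₀, hle₀⟩ := integrable_abs_sum_and_integral_le (fun n => ‖(v n).2‖ ^ 2)
    (C := Cy ^ 2) (by positivity) hN fun n => by
      rw [abs_of_nonneg (sq_nonneg _)]
      exact pow_le_pow_left₀ (norm_nonneg _) (hv n).2 2
  obtain ⟨hi₁, hle₁⟩ := integrable_sqrt_signedGram_and_integral_le (fun n => (v n).1)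
    (fun n => (v n).2) hCx hCy hN (fun n => (hv n).1) fun n => (hv n).2
  obtain ⟨hi₂, hle₂⟩ := integrable_sqrt_signedGram_and_integral_le (fun n => (v n).1)
    (fun n => (v n).1) hCx hCx hN (fun n => (hv n).1) fun n => (hv n).1
  have hi₃ := ((hi₁.const_mul 2).add (hi₂.const_mul B)).const_mul K
  refine (integral_mono_of_nonneg (Filter.Eventually.of_forall (hsup v))
    ((hi₀.add hi₃).const_mul (N : ℝ)⁻¹) (Filter.Eventually.of_forall fun σ => ?_)).trans ?_
  · refine Real.iSup_le (fun T => ?_) ?_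
    · rw [abs_mul, abs_of_pos (inv_pos.2 hN0)]
      exact mul_le_mul_of_nonneg_left (abs_signed_loss_le hp hB T.2.1 T.2.2 hN _ _ σ)
        (inv_pos.2 hN0).le
    · simp only [Pi.add_apply]
      positivity
  · rw [integral_const_mul, integral_add' hi₀ hi₃, integral_const_mul,
      integral_add' (hi₁.const_mul 2) (hi₂.const_mul B), integral_const_mul, integral_const_mul]
    gcongr
end

section
/- Let H_x, H_y be complex Hilbert spaces and (x_1, y_1),…,(x_N, y_N) ∈ H_x × H_y. Let X be the linear span of {x_1,…,x_N}, Y the linear span of {y_1,…,y_N}, and Π_X, Π_Y the orthogonal projections onto X and Y. Then for every bounded linear operator T : H_x → H_y, the empirical risk satisfies (1/N)∑_{n=1}^N ‖y_n − Π_Y T Π_X x_n‖² ≤ (1/N)∑_{n=1}^N ‖y_n − T x_n‖². -/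
open scoped InnerProductSpace

/-- `Q` is the orthogonal projection of `H` onto the subspace `K`:
every `u` is mapped into `K` and `u - Q u` is orthogonal to `K`. -/
def IsOrthoProj {H : Type*} [NormedAddCommGroup H] [InnerProductSpace ℂ H]
    (K : Submodule ℂ H) (Q : H →L[ℂ] H) : Prop :=
  ∀ u, Q u ∈ K ∧ u - Q u ∈ Kᗮ

/-- An orthogonal projection fixes every element of its range. -/
theorem IsOrthoProj.apply_of_mem {H : Type*} [NormedAddCommGroup H] [InnerProductSpace ℂ H]
    {K : Submodule ℂ H} {Q : H →L[ℂ] H} (hQ : IsOrthoProj K Q) {u : H} (hu : u ∈ K) :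
    Q u = u := by
  have hmem : u - Q u ∈ K := K.sub_mem hu (hQ u).1
  have hzero : ⟪u - Q u, u - Q u⟫_ℂ = 0 := (hQ u).2 _ hmem
  exact (sub_eq_zero.mp (inner_self_eq_zero.mp hzero)).symm

/-- An orthogonal projection is norm-nonincreasing. -/
theorem IsOrthoProj.norm_apply_le {H : Type*} [NormedAddCommGroup H] [InnerProductSpace ℂ H]
    {K : Submodule ℂ H} {Q : H →L[ℂ] H} (hQ : IsOrthoProj K Q) (u : H) :
    ‖Q u‖ ≤ ‖u‖ := by
  have hpyth := norm_add_sq_eq_norm_sq_add_norm_sq_of_inner_eq_zero (Q u) (u - Q u)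
    ((hQ u).2 _ (hQ u).1)
  rw [add_sub_cancel] at hpyth
  nlinarith [norm_nonneg u, norm_nonneg (Q u), mul_self_nonneg ‖u - Q u‖]

/-- let `X = span{x_1,…,x_N}`, `Y = span{y_1,…,y_N}` with orthogonal
projections `Π_X`, `Π_Y`.  Then for every bounded linear operator `T : H_x → H_y`,
`(1/N) ∑_n ‖y_n - Π_Y T Π_X x_n‖² ≤ (1/N) ∑_n ‖y_n - T x_n‖²`. -/
theorem statement6
    {Hx Hy : Type*} [NormedAddCommGroup Hx] [InnerProductSpace ℂ Hx] [CompleteSpace Hx]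
    [NormedAddCommGroup Hy] [InnerProductSpace ℂ Hy] [CompleteSpace Hy]
    (N : ℕ) (xs : Fin N → Hx) (ys : Fin N → Hy)
    (PX : Hx →L[ℂ] Hx) (hPX : IsOrthoProj (Submodule.span ℂ (Set.range xs)) PX)
    (PY : Hy →L[ℂ] Hy) (hPY : IsOrthoProj (Submodule.span ℂ (Set.range ys)) PY)
    (T : Hx →L[ℂ] Hy) :
    (N : ℝ)⁻¹ * ∑ n, ‖ys n - PY (T (PX (xs n)))‖ ^ 2 ≤
      (N : ℝ)⁻¹ * ∑ n, ‖ys n - T (xs n)‖ ^ 2 := by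
  gcongr with n
  have hx : PX (xs n) = xs n :=
    hPX.apply_of_mem (Submodule.subset_span (Set.mem_range_self n))
  have hy : PY (ys n) = ys n :=
    hPY.apply_of_mem (Submodule.subset_span (Set.mem_range_self n))
  calc ‖ys n - PY (T (PX (xs n)))‖ = ‖PY (ys n - T (xs n))‖ := by rw [hx, map_sub, hy]
    _ ≤ ‖ys n - T (xs n)‖ := hPY.norm_apply_le _
end
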